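/- Let ℓ = ∫_1^{√2} dξ/√(−log(ξ² − 1)). There exists a continuous even function u : ℝ → ℝ such that u(0) = √2, u(ℓ) = u(−ℓ) = 1, 1 < u(x) ≤ √2 for |x| < ℓ, 0 < u(x) < 1 for |x| > ℓ, u(x) → 0 as |x| → ∞, u is twice continuously differentiable on ℝ \ {−ℓ, ℓ}, and for all x ∉ {−ℓ, ℓ} it satisfies (1 − u(x)²)·u''(x) = u(x) together with the first-order invariant u'(x)² = −log|1 − u(x)²|. -/

import Mathlib

open Filter Set

theorem bs_inverse (S T : Set ℝ) (hS : IsOpen S) (hSc : Convex ℝ S) (hT : IsOpen T)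
    (F f : ℝ → ℝ) (hF : ∀ p ∈ S, HasDerivAt F (f p) p) (hf : ∀ p ∈ S, 0 < f p)
    (hm : ∀ p ∈ S, F p ∈ T) (hlo : ∀ x ∈ T, ∃ a ∈ S, F a < x) (hhi : ∀ x ∈ T, ∃ a ∈ S, x < F a) :
    ∃ P : ℝ → ℝ, (∀ x ∈ T, P x ∈ S) ∧ (∀ x ∈ T, F (P x) = x) ∧ (∀ p ∈ S, P (F p) = p) ∧
      StrictMonoOn F S ∧ StrictMonoOn P T ∧ (∀ x ∈ T, HasDerivAt P (f (P x))⁻¹ x) := by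
  have hc : ContinuousOn F S := fun p hp => (hF p hp).continuousAt.continuousWithinAt
  have hmono : StrictMonoOn F S := by
    apply strictMonoOn_of_deriv_pos hSc hc
    intro p hp
    rw [hS.interior_eq] at hp
    rw [(hF p hp).deriv]
    exact hf p hp
  have hsurj : ∀ x ∈ T, ∃ p ∈ S, F p = x := by
    intro x hx
    obtain ⟨a, ha, hax⟩ := hlo x hx
    obtain ⟨b, hb, hbx⟩ := hhi x hx
    have := hSc.isPreconnected.intermediate_value ha hb hc
    obtain ⟨p, hp, e⟩ := this ⟨hax.le, hbx.le⟩
    exact ⟨p, hp, e⟩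
  let P := Function.invFunOn F S
  have h1 : ∀ x ∈ T, P x ∈ S := fun x hx => Function.invFunOn_mem (hsurj x hx)
  have h2 : ∀ x ∈ T, F (P x) = x := fun x hx => Function.invFunOn_eq (hsurj x hx)
  have h3 : ∀ p ∈ S, P (F p) = p := fun p hp =>
    hmono.injOn (h1 _ (hm p hp)) hp (h2 _ (hm p hp))
  have h4 : StrictMonoOn P T := by
    intro x hx y hy hxy
    rw [← hmono.lt_iff_lt (h1 x hx) (h1 y hy), h2 x hx, h2 y hy]
    exact hxy
  refine ⟨P, h1, h2, h3, hmono, h4, fun x hx => ?_⟩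
  have hTx := hT.mem_nhds hx
  have hcont : ContinuousAt P x := by
    apply h4.continuousAt_of_image_mem_nhds hTx
    apply mem_of_superset (hS.mem_nhds (h1 x hx))
    intro p hp
    exact ⟨F p, hm p hp, h3 p hp⟩
  exact HasDerivAt.of_local_left_inverse hcont (hF _ (h1 x hx)) (hf _ (h1 x hx)).ne'
    (by filter_upwards [hTx] with y hy using h2 y hy)

noncomputable def bsf (s : ℝ) : ℝ := Real.exp (-s ^ 2) / Real.sqrt (1 + Real.exp (-s ^ 2))
noncomputable def bsg (s : ℝ) : ℝ := Real.exp (-s ^ 2) / Real.sqrt (1 - Real.exp (-s ^ 2))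

theorem bs_exp_lt {s : ℝ} (hs : 0 < s) : 0 < 1 - Real.exp (-s ^ 2) := by
  have : Real.exp (-s ^ 2) < 1 := by
    rw [Real.exp_lt_one_iff]
    nlinarith
  linarith

theorem bsf_pos (s : ℝ) : 0 < bsf s := by unfold bsf; positivity
theorem bsg_pos {s : ℝ} (hs : 0 < s) : 0 < bsg s := by
  have := bs_exp_lt hs
  unfold bsg; positivity
theorem bsf_cont : Continuous bsf := by
  unfold bsf
  refine Continuous.div (by fun_prop) (by fun_prop) (fun s => ?_)
  positivity
theorem bsg_cont : ContinuousOn bsg (Ioi 0) := by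
  unfold bsg
  refine ContinuousOn.div (by fun_prop) (by fun_prop) (fun s hs => ?_)
  have := bs_exp_lt (mem_Ioi.1 hs)
  positivity

theorem bs_int : MeasureTheory.Integrable (fun s : ℝ => Real.exp (-s ^ 2)) := by
  simpa using integrable_exp_neg_mul_sq (b := 1) one_pos

theorem bsf_int : MeasureTheory.Integrable bsf := by
  refine bs_int.mono' bsf_cont.aestronglyMeasurable (Eventually.of_forall fun s => ?_)
  rw [Real.norm_of_nonneg (bsf_pos s).le, bsf]
  apply div_le_self (by positivity)
  rw [Real.one_le_sqrt]
  have := Real.exp_pos (-s^2)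
  linarith

theorem bsg_int : MeasureTheory.IntegrableOn bsg (Ioi 1) := by
  have h := (bs_int.div_const (Real.sqrt (1 - Real.exp (-1)))).integrableOn (s := Ioi 1)
  refine MeasureTheory.Integrable.mono' h ?_ ?_
  · exact (bsg_cont.mono (Ioi_subset_Ioi zero_le_one)).aestronglyMeasurable measurableSet_Ioi
  · filter_upwards [MeasureTheory.ae_restrict_mem measurableSet_Ioi] with s hs
    have hs : 1 < s := hs
    rw [Real.norm_of_nonneg (bsg_pos (by linarith)).le, bsg]
    have h0 : 0 < 1 - Real.exp (-1) := by simp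
    have : Real.exp (-s^2) ≤ Real.exp (-1) := by
      rw [Real.exp_le_exp]; nlinarith
    gcongr

theorem bs_ell : ∫ ξ in (1 : ℝ)..Real.sqrt 2, 1 / Real.sqrt (-Real.log (ξ ^ 2 - 1)) =
    ∫ s in Ioi (0:ℝ), bsf s := by
  have h12 : (1:ℝ) ≤ Real.sqrt 2 := by rw [Real.one_le_sqrt]; norm_num
  rw [intervalIntegral.integral_of_le h12, MeasureTheory.integral_Ioc_eq_integral_Ioo]
  let φ : ℝ → ℝ := fun s => Real.sqrt (1 + Real.exp (-s ^ 2))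
  have hφ2 : ∀ s, φ s ^ 2 = 1 + Real.exp (-s ^ 2) := fun s => Real.sq_sqrt (by positivity)
  have himg : φ '' Ioi 0 = Ioo 1 (Real.sqrt 2) := by
    ext y
    constructor
    · rintro ⟨s, hs, rfl⟩
      have h1 := bs_exp_lt (mem_Ioi.1 hs)
      have h2 := Real.exp_pos (-s^2)
      constructor
      · apply Real.lt_sqrt_of_sq_lt; linarith
      · apply Real.sqrt_lt_sqrt <;> linarith
    · rintro ⟨h1, h2⟩
      have h3 : y ^ 2 < 2 := by
        rw [Real.lt_sqrt (by linarith)] at h2; exact h2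
      have h4 : 0 < y ^ 2 - 1 := by nlinarith
      have h5 : Real.log (y ^ 2 - 1) < 0 := Real.log_neg h4 (by linarith)
      refine ⟨Real.sqrt (-Real.log (y ^ 2 - 1)), Real.sqrt_pos.2 (by linarith), ?_⟩
      show Real.sqrt (1 + Real.exp (-_ ^ 2)) = y
      rw [Real.sq_sqrt (by linarith), neg_neg, Real.exp_log h4]
      rw [show 1 + (y^2 - 1) = y ^ 2 by ring, Real.sqrt_sq (by linarith)]
  have hinj : InjOn φ (Ioi 0) := by
    intro s hs t ht h
    have h : φ s = φ t := h
    have h2 : φ s ^ 2 = φ t ^ 2 := by rw [h]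
    rw [hφ2, hφ2] at h2
    have h3 := Real.exp_injective (add_left_cancel h2)
    have h3 : s ^ 2 = t ^ 2 := neg_injective h3
    exact (sq_eq_sq₀ (le_of_lt hs) (le_of_lt ht)).1 h3
  have hder : ∀ s ∈ Ioi (0:ℝ), HasDerivWithinAt φ (-(s * bsf s)) (Ioi 0) s := by
    intro s hs
    have h1 : HasDerivAt (fun s : ℝ => 1 + Real.exp (-s ^ 2)) (Real.exp (-s^2) * (-(2 * s))) s := by
      have := (((hasDerivAt_pow 2 s).fun_neg).exp).const_add 1
      simpa using this
    have h2 := h1.sqrt (by positivity)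
    refine (h2.congr_deriv ?_).hasDerivWithinAt
    unfold bsf
    field_simp
  rw [← himg, MeasureTheory.integral_image_eq_integral_abs_deriv_smul measurableSet_Ioi hder hinj]
  apply MeasureTheory.setIntegral_congr_fun measurableSet_Ioi
  intro s hs
  have hs : 0 < s := hs
  have := bsf_pos s
  simp only [hφ2, smul_eq_mul, add_sub_cancel_left, Real.log_exp, neg_neg]
  rw [Real.sqrt_sq hs.le, abs_neg, abs_of_pos (by positivity)]
  field_simp

theorem bs_P (ℓ : ℝ) (hℓ : ℓ = ∫ s in Ioi (0:ℝ), bsf s) : 0 < ℓ ∧ ∃ P : ℝ → ℝ,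
    (∀ x ∈ Ioo (-ℓ) ℓ, HasDerivAt P (bsf (P x))⁻¹ x) ∧ (∀ x ∈ Ioo (-ℓ) ℓ, P (-x) = -P x) ∧
    P 0 = 0 ∧ Tendsto P (nhdsWithin ℓ (Iio ℓ)) atTop := by
  let X : ℝ → ℝ := fun p => ∫ s in (0:ℝ)..p, bsf s
  have hX : ∀ p, HasDerivAt X (bsf p) p := fun p =>
    intervalIntegral.integral_hasDerivAt_right (bsf_cont.intervalIntegrable _ _)
      (bsf_cont.stronglyMeasurableAtFilter _ _) bsf_cont.continuousAt
  have hXm : StrictMono X := strictMono_of_deriv_pos (fun p => by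
    rw [(hX p).deriv]; exact bsf_pos p)
  have hX0 : X 0 = 0 := intervalIntegral.integral_same
  have hXodd : ∀ p, X (-p) = - X p := by
    intro p
    have h := intervalIntegral.integral_comp_neg (a := 0) (b := p) bsf
    have h2 : ∀ s, bsf (-s) = bsf s := fun s => by simp [bsf]
    simp only [h2, neg_zero] at h
    show (∫ s in (0:ℝ)..(-p), bsf s) = -(∫ s in (0:ℝ)..p, bsf s)
    rw [h, intervalIntegral.integral_symm]
  have hlim : Tendsto X atTop (nhds ℓ) := by
    rw [hℓ]
    exact MeasureTheory.intervalIntegral_tendsto_integral_Ioi 0 bsf_int.integrableOn tendsto_id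
  have hlt : ∀ p, X p < ℓ := fun p =>
    (hXm (lt_add_one p)).trans_le (hXm.monotone.ge_of_tendsto hlim _)
  have hℓ0 : 0 < ℓ := by have := hlt 0; rwa [hX0] at this
  have hgt : ∀ p, -ℓ < X p := fun p => by have := hlt (-p); rw [hXodd] at this; linarith
  have hhi : ∀ x < ℓ, ∃ a, x < X a := fun x hx => (hlim.eventually (lt_mem_nhds hx)).exists
  obtain ⟨P, -, h2, h3, -, h5, h6⟩ := bs_inverse univ (Ioo (-ℓ) ℓ) isOpen_univ convex_univ isOpen_Ioo
    X bsf (fun p _ => hX p) (fun p _ => bsf_pos p) (fun p _ => ⟨hgt p, hlt p⟩)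
    (fun x hx => by
      obtain ⟨a, ha⟩ := hhi (-x) (by linarith [hx.1])
      exact ⟨-a, mem_univ _, by rw [hXodd]; linarith⟩)
    (fun x hx => by
      obtain ⟨a, ha⟩ := hhi x hx.2
      exact ⟨a, mem_univ _, ha⟩)
  refine ⟨hℓ0, P, h6, ?_, ?_, ?_⟩
  · intro x hx
    have h := h3 (-P x) (mem_univ _)
    rw [hXodd, h2 x hx] at h
    exact h
  · have h := h3 0 (mem_univ _)
    rwa [hX0] at h
  · rw [tendsto_atTop]
    intro M
    filter_upwards [Ioo_mem_nhdsLT (hlt M)] with x hx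
    have h := h5 ⟨hgt M, hlt M⟩ ⟨(hgt M).trans hx.1, hx.2⟩ hx.1
    rw [h3 M (mem_univ _)] at h
    exact h.le

theorem bs_Q : ∃ Q : ℝ → ℝ, (∀ y < 0, 0 < Q y) ∧
    (∀ y < 0, HasDerivAt Q (bsg (Q y))⁻¹ y) ∧
    Tendsto Q (nhdsWithin 0 (Iio 0)) atTop ∧ Tendsto Q atBot (nhds 0) := by
  let C := ∫ s in Ioi (1:ℝ), bsg s
  let X : ℝ → ℝ := fun p => (∫ s in (1:ℝ)..p, bsg s) - C
  have hii : ∀ a b : ℝ, 0 < a → 0 < b → IntervalIntegrable bsg MeasureTheory.volume a b := by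
    intro a b ha hb
    apply ContinuousOn.intervalIntegrable
    apply bsg_cont.mono
    intro s hs
    exact lt_of_lt_of_le (lt_min ha hb) hs.1
  have hX : ∀ p ∈ Ioi (0:ℝ), HasDerivAt X (bsg p) p := fun p hp =>
    (intervalIntegral.integral_hasDerivAt_right (hii 1 p one_pos hp)
      (bsg_cont.stronglyMeasurableAtFilter isOpen_Ioi p hp)
      (bsg_cont.continuousAt (Ioi_mem_nhds hp))).sub_const C
  have hXm : StrictMonoOn X (Ioi 0) := by
    apply strictMonoOn_of_deriv_pos (convex_Ioi 0)
      (fun p hp => (hX p hp).continuousAt.continuousWithinAt)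
    intro p hp
    rw [interior_Ioi] at hp
    rw [(hX p hp).deriv]; exact bsg_pos hp
  have hlim : Tendsto X atTop (nhds 0) := by
    have := (MeasureTheory.intervalIntegral_tendsto_integral_Ioi 1 bsg_int tendsto_id).sub_const C
    simpa [C] using this
  have hlt : ∀ p ∈ Ioi (0:ℝ), X p < 0 := fun p hp => by
    have hp : 0 < p := hp
    refine (hXm hp (show p + 1 ∈ Ioi 0 from mem_Ioi.2 (by linarith)) (lt_add_one p)).trans_le ?_
    apply ge_of_tendsto hlim
    filter_upwards [eventually_ge_atTop (p+1)] with q hq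
    exact hXm.monotoneOn (mem_Ioi.2 (by linarith)) (mem_Ioi.2 (by linarith)) hq
  have hbd : ∀ p ∈ Ioo (0:ℝ) 1, X p ≤ Real.exp (-1) * Real.log p - C := by
    intro p hp
    have h1 : ∫ s in p..1, Real.exp (-1) * s⁻¹ ≤ ∫ s in p..1, bsg s := by
      apply intervalIntegral.integral_mono_on hp.2.le
      · apply ContinuousOn.intervalIntegrable
        refine ContinuousOn.mul continuousOn_const (continuousOn_inv₀.mono ?_)
        intro s hs
        rw [uIcc_of_le hp.2.le] at hs
        exact (hp.1.trans_le hs.1).ne'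
      · exact hii p 1 hp.1 one_pos
      · intro s hs
        have hs0 : 0 < s := hp.1.trans_le hs.1
        have he := bs_exp_lt hs0
        rw [bsg, ← div_eq_mul_inv]
        have h2 : Real.sqrt (1 - Real.exp (-s^2)) ≤ s := by
          apply Real.sqrt_le_iff.2 ⟨hs0.le, ?_⟩
          linarith [Real.add_one_le_exp (-s^2)]
        have h3 : Real.exp (-1) ≤ Real.exp (-s^2) := by
          rw [Real.exp_le_exp]; nlinarith [hs.2]
        gcongr
    rw [intervalIntegral.integral_const_mul, integral_inv_of_pos hp.1 one_pos, one_div,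
      Real.log_inv, intervalIntegral.integral_symm] at h1
    show (∫ s in (1:ℝ)..p, bsg s) - C ≤ _
    linarith
  have hbot : Tendsto X (nhdsWithin 0 (Ioi 0)) atBot := by
    have h1 : Tendsto (fun p => Real.exp (-1) * Real.log p - C) (nhdsWithin 0 (Ioi 0)) atBot :=
      tendsto_atBot_add_const_right _ (-C)
        (Real.tendsto_log_nhdsGT_zero.const_mul_atBot (Real.exp_pos (-1)))
    refine tendsto_atBot_mono' _ ?_ h1
    filter_upwards [Ioo_mem_nhdsGT one_pos] with p hp using hbd p hp
  obtain ⟨Q, h1, h2, h3, -, h5, h6⟩ := bs_inverse (Ioi 0) (Iio 0) isOpen_Ioi (convex_Ioi 0) isOpen_Iio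
    X bsg hX (fun p hp => bsg_pos hp) hlt
    (fun x hx => by
      obtain ⟨a, ha, hb⟩ := ((hbot.eventually (eventually_lt_atBot x)).and self_mem_nhdsWithin).exists
      exact ⟨a, hb, ha⟩)
    (fun x hx => by
      obtain ⟨a, ha, hb⟩ := ((hlim.eventually (lt_mem_nhds hx)).and (eventually_gt_atTop 0)).exists
      exact ⟨a, hb, ha⟩)
  refine ⟨Q, h1, h6, ?_, ?_⟩
  · rw [tendsto_atTop]
    intro M
    have hM : max M 1 ∈ Ioi (0:ℝ) := mem_Ioi.2 (lt_max_of_lt_right one_pos)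
    filter_upwards [Ioo_mem_nhdsLT (hlt _ hM)] with x hx
    have h := h5 (hlt _ hM) hx.2 hx.1
    rw [h3 _ hM] at h
    exact (le_max_left _ _).trans h.le
  · rw [Metric.tendsto_nhds]
    intro ε hε
    filter_upwards [eventually_lt_atBot (X ε)] with y hy
    have hy0 := hy.trans (hlt ε hε)
    have h := h5 hy0 (hlt ε hε) hy
    rw [h3 ε hε] at h
    rw [Real.dist_eq, sub_zero, abs_of_pos (h1 y hy0)]
    exact h

theorem bs_main (ℓ : ℝ)
    (hℓ : ℓ = ∫ ξ in (1 : ℝ)..Real.sqrt 2, 1 / Real.sqrt (-Real.log (ξ ^ 2 - 1))) :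
    ∃ u : ℝ → ℝ, Continuous u ∧
      (∀ x : ℝ, u (-x) = u x) ∧ u 0 = Real.sqrt 2 ∧ u ℓ = 1 ∧
      (∀ x : ℝ, |x| < ℓ → 1 < u x ∧ u x ≤ Real.sqrt 2) ∧
      (∀ x : ℝ, ℓ < |x| → 0 < u x ∧ u x < 1) ∧
      Tendsto u (cocompact ℝ) (nhds 0) ∧
      ∀ x, |x| ≠ ℓ → ∃ v : ℝ → ℝ, (∀ᶠ y in nhds x, HasDerivAt u (v y) y) ∧
        HasDerivAt v (u x / (1 - u x ^ 2)) x ∧ v x ^ 2 = -Real.log |1 - u x ^ 2| := by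
  rw [bs_ell] at hℓ
  obtain ⟨hℓ0, P, hP, hPodd, hP0, hPlim⟩ := bs_P ℓ hℓ
  obtain ⟨Q, hQ, hQd, hQlim, hQbot⟩ := bs_Q
  let w : ℝ → ℝ := fun r => if r < ℓ then Real.sqrt (1 + Real.exp (-P r ^ 2)) else
    if r = ℓ then 1 else Real.sqrt (1 - Real.exp (-Q (ℓ - r) ^ 2))
  have w1 : ∀ r, r < ℓ → w r = Real.sqrt (1 + Real.exp (-P r ^ 2)) := fun r hr => if_pos hr
  have w2 : w ℓ = 1 := by simp [w]
  have w3 : ∀ r, ℓ < r → w r = Real.sqrt (1 - Real.exp (-Q (ℓ - r) ^ 2)) := fun r hr => by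
    simp [w, hr.not_gt, hr.ne']
  let u : ℝ → ℝ := fun x => w |x|
  have u1 : ∀ x, |x| < ℓ → u x = Real.sqrt (1 + Real.exp (-P x ^ 2)) := by
    intro x hx
    show w |x| = _
    rw [w1 _ hx]
    rcases abs_choice x with h | h
    · rw [h]
    · rw [h, hPodd x (abs_lt.1 hx), neg_sq]
  have huev : ∀ x, u (-x) = u x := fun x => by simp [u]
  have sq1 : ∀ x, |x| < ℓ → u x ^ 2 = 1 + Real.exp (-P x ^ 2) := fun x hx => by
    rw [u1 x hx, Real.sq_sqrt (by positivity)]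
  have hexp : ∀ x, ℓ < |x| → 0 < 1 - Real.exp (-Q (ℓ - |x|) ^ 2) := fun x hx =>
    bs_exp_lt (hQ _ (by linarith))
  have sq3 : ∀ x, ℓ < |x| → u x ^ 2 = 1 - Real.exp (-Q (ℓ - |x|) ^ 2) := fun x hx => by
    show w |x| ^ 2 = _
    rw [w3 _ hx, Real.sq_sqrt (hexp x hx).le]
  have d1 : ∀ x, |x| < ℓ → HasDerivAt u (-P x) x := by
    intro x hx
    have h1 : HasDerivAt (fun s : ℝ => 1 + Real.exp (-P s ^ 2))
        (Real.exp (-P x ^ 2) * (-(2 * P x * (bsf (P x))⁻¹))) x := by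
      have := ((((hP x (abs_lt.1 hx)).fun_pow 2).fun_neg).exp).const_add 1
      simpa using this
    have h2 := h1.sqrt (by positivity)
    have h3 : u =ᶠ[nhds x] fun s => Real.sqrt (1 + Real.exp (-P s ^ 2)) := by
      filter_upwards [(isOpen_lt continuous_abs continuous_const).mem_nhds hx] with y hy
      exact u1 y hy
    refine (h2.congr_of_eventuallyEq h3).congr_deriv ?_
    unfold bsf
    field_simp
  have d3 : ∀ x, ℓ < x → HasDerivAt u (-Q (ℓ - x)) x := by
    intro x hx
    have hpos := bs_exp_lt (hQ (ℓ - x) (by linarith))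
    have h0 : HasDerivAt (fun s => Q (ℓ - s)) (-(bsg (Q (ℓ - x)))⁻¹) x := by
      have := (hQd (ℓ - x) (by linarith)).comp x ((hasDerivAt_id x).const_sub ℓ)
      simpa [Function.comp_def] using this
    have h1 : HasDerivAt (fun s : ℝ => 1 - Real.exp (-Q (ℓ - s) ^ 2))
        (-(Real.exp (-Q (ℓ - x) ^ 2) * (2 * Q (ℓ - x) * (bsg (Q (ℓ - x)))⁻¹))) x := by
      have := (((h0.fun_pow 2).fun_neg).exp).const_sub 1
      simpa using this
    have h2 := h1.sqrt hpos.ne'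
    have h3 : u =ᶠ[nhds x] fun s => Real.sqrt (1 - Real.exp (-Q (ℓ - s) ^ 2)) := by
      filter_upwards [Ioi_mem_nhds hx] with y hy
      have hy : ℓ < y := hy
      show w |y| = _
      rw [abs_of_pos (hℓ0.trans hy), w3 y hy]
    refine (h2.congr_of_eventuallyEq h3).congr_deriv ?_
    unfold bsg
    have := Real.sqrt_pos.2 hpos
    field_simp
  have d4 : ∀ x, x < -ℓ → HasDerivAt u (Q (ℓ + x)) x := by
    intro x hx
    have h := (d3 (-x) (by linarith)).comp x (hasDerivAt_neg x)
    have h2 : u ∘ Neg.neg = u := funext huev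
    have h3 : u ∘ (fun y : ℝ => -y) = u := funext huev
    simpa [h2, h3] using h
  have key : ∀ x, |x| ≠ ℓ → ∃ v : ℝ → ℝ, (∀ᶠ y in nhds x, HasDerivAt u (v y) y) ∧
        HasDerivAt v (u x / (1 - u x ^ 2)) x ∧ v x ^ 2 = -Real.log |1 - u x ^ 2| := by
    intro x hx
    rcases lt_or_gt_of_ne hx with h | h
    · refine ⟨fun y => -P y, ?_, ?_, ?_⟩
      · filter_upwards [(isOpen_lt continuous_abs continuous_const).mem_nhds h] with y hy
        exact d1 y hy
      · refine (hP x (abs_lt.1 h)).fun_neg.congr_deriv ?_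
        rw [sq1 x h, u1 x h, bsf, sub_add_cancel_left, inv_div, div_neg]
      · rw [sq1 x h, sub_add_cancel_left, abs_neg, abs_of_pos (Real.exp_pos _), Real.log_exp]
        ring
    · have hu : u x = Real.sqrt (1 - Real.exp (-Q (ℓ - |x|) ^ 2)) := w3 _ h
      rcases lt_abs.1 h with h' | h'
      · have hx : |x| = x := abs_of_pos (hℓ0.trans h')
        refine ⟨fun y => -Q (ℓ - y), ?_, ?_, ?_⟩
        · filter_upwards [Ioi_mem_nhds h'] with y hy using d3 y hy
        · have := ((hQd (ℓ - x) (by linarith)).comp x ((hasDerivAt_id x).const_sub ℓ)).fun_neg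
          refine this.congr_deriv ?_
          rw [sq3 x h, hu, hx, bsg, sub_sub_cancel, inv_div]
          ring
        · rw [sq3 x h, hx, sub_sub_cancel, abs_of_pos (Real.exp_pos _), Real.log_exp]
          ring
      · have hx : |x| = -x := abs_of_neg (by linarith)
        refine ⟨fun y => Q (ℓ + y), ?_, ?_, ?_⟩
        · filter_upwards [Iio_mem_nhds (show x < -ℓ by linarith)] with y hy using d4 y hy
        · have := ((hQd (ℓ + x) (by linarith)).comp x ((hasDerivAt_id x).const_add ℓ))
          refine this.congr_deriv ?_
          rw [sq3 x h, hu, hx, bsg, sub_sub_cancel, inv_div, sub_neg_eq_add]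
          ring
        · rw [sq3 x h, hx, sub_sub_cancel, abs_of_pos (Real.exp_pos _), Real.log_exp,
            sub_neg_eq_add]
          ring
  have sqlim : ∀ {F : Filter ℝ} {R : ℝ → ℝ}, Tendsto R F atTop →
      Tendsto (fun r => Real.exp (-R r ^ 2)) F (nhds 0) := by
    intro F R h
    exact Real.tendsto_exp_neg_atTop_nhds_zero.comp ((tendsto_pow_atTop two_ne_zero).comp h)
  have wc : ContinuousAt w ℓ := by
    rw [continuousAt_iff_continuous_left'_right']
    constructor
    · have h := ((sqlim hPlim).const_add 1).sqrt
      rw [add_zero, Real.sqrt_one] at h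
      show Tendsto w _ (nhds (w ℓ))
      rw [w2]
      refine h.congr' ?_
      filter_upwards [self_mem_nhdsWithin] with r hr using (w1 r hr).symm
    · have hs : Tendsto (fun r => ℓ - r) (nhdsWithin ℓ (Ioi ℓ)) (nhdsWithin 0 (Iio 0)) := by
        apply tendsto_nhdsWithin_of_tendsto_nhds_of_eventually_within
        · apply tendsto_nhdsWithin_of_tendsto_nhds
          have : Continuous fun r : ℝ => ℓ - r := by fun_prop
          simpa using this.tendsto ℓ
        · filter_upwards [self_mem_nhdsWithin] with r hr
          have hr : ℓ < r := hr
          exact mem_Iio.2 (by linarith)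
      have h := ((sqlim (hQlim.comp hs)).const_sub 1).sqrt
      rw [sub_zero, Real.sqrt_one] at h
      show Tendsto w _ (nhds (w ℓ))
      rw [w2]
      refine h.congr' ?_
      filter_upwards [self_mem_nhdsWithin] with r hr using (w3 r hr).symm
  refine ⟨u, ?_, huev, ?_, ?_, ?_, ?_, ?_, key⟩
  · rw [continuous_iff_continuousAt]
    intro x
    by_cases hx : |x| = ℓ
    · have : ContinuousAt w |x| := by rw [hx]; exact wc
      exact this.comp continuous_abs.continuousAt
    · obtain ⟨v, hv, -⟩ := key x hx
      exact hv.self_of_nhds.continuousAt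
  · rw [u1 0 (by simpa using hℓ0), hP0]
    norm_num
  · show w |ℓ| = 1
    rw [abs_of_pos hℓ0, w2]
  · intro x hx
    rw [u1 x hx]
    have h1 := Real.exp_pos (-P x ^ 2)
    have h2 : Real.exp (-P x ^ 2) ≤ 1 := by
      rw [Real.exp_le_one_iff]; nlinarith
    constructor
    · apply Real.lt_sqrt_of_sq_lt; linarith
    · apply Real.sqrt_le_sqrt; linarith
  · intro x hx
    have hu : u x = Real.sqrt (1 - Real.exp (-Q (ℓ - |x|) ^ 2)) := w3 _ hx
    rw [hu]
    refine ⟨Real.sqrt_pos.2 (hexp x hx), ?_⟩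
    rw [Real.sqrt_lt' one_pos]
    have h1 := Real.exp_pos (-Q (ℓ - |x|) ^ 2)
    linarith
  · have hw : Tendsto w atTop (nhds 0) := by
      have hs : Tendsto (fun r => ℓ - r) atTop atBot := by
        simpa [sub_eq_add_neg] using tendsto_atBot_add_const_left atTop ℓ tendsto_neg_atTop_atBot
      have hc : Continuous fun q : ℝ => Real.sqrt (1 - Real.exp (-q ^ 2)) := by fun_prop
      have h := (hc.tendsto 0).comp (hQbot.comp hs)
      simp only [ne_eq, OfNat.ofNat_ne_zero, not_false_eq_true, zero_pow, neg_zero, Real.exp_zero,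
        sub_self, Real.sqrt_zero] at h
      refine h.congr' ?_
      filter_upwards [eventually_gt_atTop ℓ] with r hr using (w3 r hr).symm
    exact hw.comp (tendsto_norm_cocompact_atTop (E := ℝ))


/-- existence of the bell-shaped soliton of (1 − u²)u'' = u:
with ℓ = ∫_1^{√2} dξ/√(−log(ξ² − 1)), there is a continuous even function
with u(0) = √2, u(±ℓ) = 1, 1 < u ≤ √2 inside (−ℓ,ℓ), 0 < u < 1 outside,
decaying at infinity, C² away from ±ℓ, satisfying the equation and the
first-order invariant u'² = −log|1 − u²| away from ±ℓ. -/
theorem exists_bell_soliton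
    (ℓ : ℝ)
    (hℓ : ℓ = ∫ ξ in (1 : ℝ)..Real.sqrt 2, 1 / Real.sqrt (-Real.log (ξ ^ 2 - 1))) :
    ∃ u : ℝ → ℝ,
      Continuous u ∧
      (∀ x : ℝ, u (-x) = u x) ∧
      u 0 = Real.sqrt 2 ∧
      u ℓ = 1 ∧ u (-ℓ) = 1 ∧
      (∀ x : ℝ, |x| < ℓ → 1 < u x ∧ u x ≤ Real.sqrt 2) ∧
      (∀ x : ℝ, ℓ < |x| → 0 < u x ∧ u x < 1) ∧
      Tendsto u (cocompact ℝ) (nhds 0) ∧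
      ContDiffOn ℝ 2 u ({-ℓ, ℓ} : Set ℝ)ᶜ ∧
      (∀ x : ℝ, x ∉ ({-ℓ, ℓ} : Set ℝ) → (1 - u x ^ 2) * deriv (deriv u) x = u x) ∧
      (∀ x : ℝ, x ∉ ({-ℓ, ℓ} : Set ℝ) →
        (deriv u x) ^ 2 = -Real.log |1 - u x ^ 2|) := by

  obtain ⟨u, hc, hev, h0, h1, hin, hout, hlim, key⟩ := bs_main ℓ hℓ
  have hmem : ∀ x, x ∉ ({-ℓ, ℓ} : Set ℝ) → |x| ≠ ℓ := by
    intro x hx h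
    apply hx
    rcases abs_choice x with h' | h'
    · right; show x = ℓ; linarith
    · left; linarith
  have hne : ∀ x, |x| ≠ ℓ → 1 - u x ^ 2 ≠ 0 := by
    intro x hx
    rcases lt_or_gt_of_ne hx with h | h
    · have := (hin x h).1
      nlinarith
    · have := hout x h
      nlinarith
  have hd1 : ∀ x, |x| ≠ ℓ → DifferentiableAt ℝ u x := by
    intro x hx
    obtain ⟨v, hv, -⟩ := key x hx
    exact hv.self_of_nhds.differentiableAt
  have hd2 : ∀ x, |x| ≠ ℓ → HasDerivAt (deriv u) (u x / (1 - u x ^ 2)) x := by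
    intro x hx
    obtain ⟨v, hv, hv2, -⟩ := key x hx
    exact hv2.congr_of_eventuallyEq (hv.mono fun y hy => hy.deriv)
  have hopen : IsOpen (({-ℓ, ℓ} : Set ℝ)ᶜ) := (Set.toFinite _).isClosed.isOpen_compl
  refine ⟨u, hc, hev, h0, h1, by rw [hev, h1], hin, hout, hlim, ?_, ?_, ?_⟩
  · rw [show (2 : WithTop ℕ∞) = 1 + 1 by norm_num, contDiffOn_succ_iff_deriv_of_isOpen hopen]
    refine ⟨fun x hx => (hd1 x (hmem x hx)).differentiableWithinAt, by simp, ?_⟩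
    rw [show (1 : WithTop ℕ∞) = 0 + 1 by norm_num, contDiffOn_succ_iff_deriv_of_isOpen hopen]
    refine ⟨fun x hx => (hd2 x (hmem x hx)).differentiableAt.differentiableWithinAt, by simp, ?_⟩
    rw [contDiffOn_zero]
    have : ContinuousOn (fun x => u x / (1 - u x ^ 2)) ({-ℓ, ℓ} : Set ℝ)ᶜ :=
      ContinuousOn.div (by fun_prop) (by fun_prop) (fun x hx => hne x (hmem x hx))
    exact this.congr fun x hx => (hd2 x (hmem x hx)).deriv
  · intro x hx
    rw [(hd2 x (hmem x hx)).deriv]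
    exact mul_div_cancel₀ _ (hne x (hmem x hx))
  · intro x hx
    obtain ⟨v, hv, -, hv3⟩ := key x (hmem x hx)
    rw [hv.self_of_nhds.deriv, hv3]
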